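/- Let P be a real polynomial on ℝ^n and define I_r(λ) := ∫_{Δ_r^n} e^{i λ P(x)} dλ_n(x) for λ ∈ ℝ. Then there exists a constant C > 0, independent of λ and r, such that for all |λ| > 1 and all r > 1, |I_r(λ)| ≤ C·r^{n−1}·|λ|^{−1/ad(P)}. -/

import Mathlib

open MeasureTheory Metric MvPolynomial
open scoped ENNReal NNReal

/-- The open cube `Δ_r^n = (-r, r)^n` in `ℝ^n`. -/
def cube (n : ℕ) (r : ℝ) : Set (EuclideanSpace ℝ (Fin n)) :=
  {x | ∀ i, x i ∈ Set.Ioo (-r) r}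

/-- `α` is an admissible index (i.e. `x^α` is an admissible monomial) for the real
polynomial `P` on `ℝ^n`. -/
def IsAdmissibleIndex {n : ℕ} (P : MvPolynomial (Fin n) ℝ) (α : Fin n →₀ ℕ) : Prop :=
  MvPolynomial.coeff α P ≠ 0 ∧
  ∃ σ : Equiv.Perm (Fin n),
    (∃ h : 0 < n, 1 ≤ α (σ ⟨0, h⟩)) ∧
    ∀ β : Fin n →₀ ℕ, β ≠ α → MvPolynomial.coeff β P ≠ 0 →
      ∃ j : Fin n, β (σ j) < α (σ j) ∧ ∀ k : Fin n, k < j → α (σ k) = β (σ k)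

/-- The admissible degree `ad(P) = min {|α| : α admissible index for P}`. -/
noncomputable def admissibleDegree {n : ℕ} (P : MvPolynomial (Fin n) ℝ) : ℕ :=
  sInf {k : ℕ | ∃ α : Fin n →₀ ℕ, IsAdmissibleIndex P α ∧ (∑ i, α i) = k}


/-- base van der Corput -/
lemma vdc_base (p : Polynomial ℝ) (A B μ : ℝ) (hAB : A ≤ B) (hμ : 0 < μ)
    (h1 : ∀ x ∈ Set.Icc A B, μ ≤ p.derivative.eval x)
    (h2 : (∀ x ∈ Set.Icc A B, 0 ≤ p.derivative.derivative.eval x) ∨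
      (∀ x ∈ Set.Icc A B, p.derivative.derivative.eval x ≤ 0)) :
    ‖∫ x in A..B, Complex.exp (Complex.I * Complex.ofReal (p.eval x))‖ ≤ 4 * μ⁻¹ := by
  set q := p.derivative with hq
  have hpos : ∀ x ∈ Set.Icc A B, 0 < q.eval x := fun x hx => hμ.trans_le (h1 x hx)
  have hu : Set.uIcc A B = Set.Icc A B := Set.uIcc_of_le hAB
  let e : ℝ → ℂ := fun x => Complex.exp (Complex.I * Complex.ofReal (p.eval x))
  have hen : ∀ x, ‖e x‖ = 1 := by
    intro x
    simp only [e]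
    rw [mul_comm, Complex.norm_exp_ofReal_mul_I]
  let E : ℝ → ℂ := fun x => e x * ((-(q.derivative.eval x) / (q.eval x)^2 : ℝ) : ℂ) * (-Complex.I)
  let G : ℝ → ℂ := fun x => e x * (((q.eval x)⁻¹ : ℝ) : ℂ) * (-Complex.I)
  have hec : Continuous e := by
    simp only [e]
    have := p.continuous
    fun_prop
  have hinvd : ∀ x ∈ Set.Icc A B, HasDerivAt (fun x => (q.eval x)⁻¹)
      (-(q.derivative.eval x) / (q.eval x)^2) x := fun x hx =>
    (q.hasDerivAt x).inv (hpos x hx).ne'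
  have hrc : ContinuousOn (fun x => (-(q.derivative.eval x) / (q.eval x)^2 : ℝ)) (Set.Icc A B) := by
    apply ContinuousOn.div
    · exact (q.derivative.continuous.neg).continuousOn
    · exact (q.continuous.pow 2).continuousOn
    · intro x hx
      exact pow_ne_zero _ (hpos x hx).ne'
  have hri : IntervalIntegrable (fun x => (-(q.derivative.eval x) / (q.eval x)^2 : ℝ)) volume A B :=
    ContinuousOn.intervalIntegrable (by rwa [hu])
  have hEi : IntervalIntegrable E volume A B := by
    apply ContinuousOn.intervalIntegrable
    rw [hu]
    exact (hec.continuousOn.mul (Complex.continuous_ofReal.comp_continuousOn hrc)).mul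
      continuousOn_const
  have hei : IntervalIntegrable e volume A B := hec.intervalIntegrable _ _
  have hder : ∀ x ∈ Set.uIcc A B, HasDerivAt G (e x + E x) x := by
    rw [hu]
    intro x hx
    have he : HasDerivAt e (e x * (Complex.I * ((q.eval x : ℝ) : ℂ))) x :=
      (((p.hasDerivAt x).ofReal_comp).const_mul Complex.I).cexp
    have := (he.mul (hinvd x hx).ofReal_comp).mul_const (-Complex.I)
    refine HasDerivAt.congr_deriv (f := G) this ?_
    simp only [E]
    have h0 : ((q.eval x : ℝ) : ℂ) ≠ 0 := by exact_mod_cast (hpos x hx).ne'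
    push_cast
    field_simp
    ring_nf
    simp
  have hint := intervalIntegral.integral_eq_sub_of_hasDerivAt hder (hei.add hEi)
  rw [intervalIntegral.integral_add hei hEi] at hint
  have heq : ∫ x in A..B, e x = G B - G A - ∫ x in A..B, E x := by rw [← hint]; ring
  have hGn : ∀ x ∈ Set.Icc A B, ‖G x‖ ≤ μ⁻¹ := by
    intro x hx
    simp only [G, norm_mul, hen, norm_neg, Complex.norm_I, Complex.norm_real, one_mul, mul_one]
    rw [Real.norm_of_nonneg (inv_pos.2 (hpos x hx)).le]
    exact inv_anti₀ hμ (h1 x hx)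
  have hA : A ∈ Set.Icc A B := Set.left_mem_Icc.2 hAB
  have hB : B ∈ Set.Icc A B := Set.right_mem_Icc.2 hAB
  have hrint := intervalIntegral.integral_eq_sub_of_hasDerivAt
    (f := fun x => (q.eval x)⁻¹) (by rw [hu]; exact hinvd) hri
  have hEn : ‖∫ x in A..B, E x‖ ≤ 2 * μ⁻¹ := by
    have h3 : ‖∫ x in A..B, E x‖ ≤ ∫ x in A..B, |(-(q.derivative.eval x) / (q.eval x)^2 : ℝ)| := by
      refine (intervalIntegral.norm_integral_le_integral_norm hAB).trans (le_of_eq ?_)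
      congr 1
      ext x
      simp only [E, norm_mul, hen, norm_neg, Complex.norm_I, Complex.norm_real, one_mul, mul_one]
      rfl
    have iA := inv_anti₀ hμ (h1 A hA)
    have iB := inv_anti₀ hμ (h1 B hB)
    have jA := inv_pos.2 (hpos A hA)
    have jB := inv_pos.2 (hpos B hB)
    have kk := inv_pos.2 hμ
    rcases h2 with h2 | h2
    · have : ∫ x in A..B, |(-(q.derivative.eval x) / (q.eval x)^2 : ℝ)|
          = ∫ x in A..B, -(-(q.derivative.eval x) / (q.eval x)^2 : ℝ) := by
        apply intervalIntegral.integral_congr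
        rw [hu]
        intro x hx
        simp only
        rw [abs_of_nonpos]
        exact div_nonpos_of_nonpos_of_nonneg (neg_nonpos.2 (h2 x hx)) (sq_nonneg _)
      rw [this, intervalIntegral.integral_neg, hrint] at h3
      linarith
    · have : ∫ x in A..B, |(-(q.derivative.eval x) / (q.eval x)^2 : ℝ)|
          = ∫ x in A..B, (-(q.derivative.eval x) / (q.eval x)^2 : ℝ) := by
        apply intervalIntegral.integral_congr
        rw [hu]
        intro x hx
        simp only
        rw [abs_of_nonneg]
        exact div_nonneg (neg_nonneg.2 (h2 x hx)) (sq_nonneg _)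
      rw [this, hrint] at h3
      linarith
  change ‖∫ x in A..B, e x‖ ≤ _
  rw [heq]
  have a1 := norm_sub_le (G B - G A) (∫ x in A..B, E x)
  have a2 := norm_sub_le (G B) (G A)
  have a3 := hGn A hA
  have a4 := hGn B hB
  linarith

lemma osc_neg (p : Polynomial ℝ) (A B : ℝ) :
    ‖∫ x in A..B, Complex.exp (Complex.I * Complex.ofReal ((-p).eval x))‖ =
    ‖∫ x in A..B, Complex.exp (Complex.I * Complex.ofReal (p.eval x))‖ := by
  rw [← RCLike.norm_conj (∫ x in A..B, Complex.exp (Complex.I * Complex.ofReal (p.eval x)))]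
  rw [intervalIntegral.intervalIntegral_eq_integral_uIoc,
    intervalIntegral.intervalIntegral_eq_integral_uIoc]
  rw [show ((starRingEnd ℂ) ((if A ≤ B then (1:ℝ) else -1) •
      ∫ x in Set.uIoc A B, Complex.exp (Complex.I * Complex.ofReal (p.eval x)))) =
      (if A ≤ B then (1:ℝ) else -1) •
      (starRingEnd ℂ) (∫ x in Set.uIoc A B, Complex.exp (Complex.I * Complex.ofReal (p.eval x))) by
    split_ifs <;> simp]
  rw [← integral_conj]
  congr 3
  ext x
  rw [← Complex.exp_conj]
  simp

lemma osc_triv (p : Polynomial ℝ) (A B : ℝ) (h : A ≤ B) :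
    ‖∫ x in A..B, Complex.exp (Complex.I * Complex.ofReal (p.eval x))‖ ≤ B - A := by
  have := intervalIntegral.norm_integral_le_of_norm_le_const (a := A) (b := B) (C := 1)
    (f := fun x => Complex.exp (Complex.I * Complex.ofReal (p.eval x))) (by
      intro x _
      rw [mul_comm, Complex.norm_exp_ofReal_mul_I])
  rwa [one_mul, abs_of_nonneg (by linarith)] at this

/-- van der Corput -/
lemma vdc (k : ℕ) : ∃ K : ℝ, 0 < K ∧ ∀ (p : Polynomial ℝ) (A B μ : ℝ), A ≤ B → 0 < μ →
    (∀ x ∈ Set.Icc A B, μ ≤ (Polynomial.derivative^[k+1] p).eval x) →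
    ((∀ x ∈ Set.Icc A B, 0 ≤ (Polynomial.derivative^[k+2] p).eval x) ∨
      (∀ x ∈ Set.Icc A B, (Polynomial.derivative^[k+2] p).eval x ≤ 0)) →
    ‖∫ x in A..B, Complex.exp (Complex.I * Complex.ofReal (p.eval x))‖ ≤
      K * μ ^ (-(1:ℝ) / ((k:ℝ)+1)) := by
  induction k with
  | zero =>
    refine ⟨4, by norm_num, ?_⟩
    intro p A B μ hAB hμ h1 h2
    have := vdc_base p A B μ hAB hμ h1 h2
    simpa [Real.rpow_neg_one] using this
  | succ k ih =>
    obtain ⟨K, hK, ih⟩ := ih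
    refine ⟨2 + 2 * K, by positivity, ?_⟩
    intro p A B μ hAB hμ h1 _
    set f := Polynomial.derivative^[k+1] p with hf
    have hf' : Polynomial.derivative^[k+1+1] p = f.derivative := by
      rw [Function.iterate_succ_apply']
    rw [hf'] at h1
    set δ : ℝ := μ ^ (((k:ℝ)+1)/((k:ℝ)+2)) with hδ
    have hδp : 0 < δ := Real.rpow_pos_of_pos hμ _
    have hgrow : ∀ x ∈ Set.Icc A B, ∀ y ∈ Set.Icc A B, x ≤ y → μ * (y - x) ≤ f.eval y - f.eval x := by
      apply Convex.mul_sub_le_image_sub_of_le_deriv (convex_Icc A B)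
      · exact f.continuous.continuousOn
      · exact f.differentiable.differentiableOn
      · intro x hx
        rw [Polynomial.deriv]
        exact h1 x (interior_subset hx)
    have hA : A ∈ Set.Icc A B := Set.left_mem_Icc.2 hAB
    have hB : B ∈ Set.Icc A B := Set.right_mem_Icc.2 hAB
    obtain ⟨c, hc, hc1, hc2⟩ : ∃ c ∈ Set.Icc A B, (A < c → f.eval c ≤ 0) ∧
        (c < B → 0 ≤ f.eval c) := by
      by_cases hfa : 0 ≤ f.eval A
      · exact ⟨A, hA, fun h => absurd h (lt_irrefl _), fun _ => hfa⟩
      by_cases hfb : f.eval B ≤ 0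
      · exact ⟨B, hB, fun _ => hfb, fun h => absurd h (lt_irrefl _)⟩
      push Not at hfa hfb
      obtain ⟨c, hc, hc0⟩ := intermediate_value_Icc hAB (f := fun x => f.eval x)
        f.continuous.continuousOn (show (0:ℝ) ∈ _ from ⟨hfa.le, hfb.le⟩)
      exact ⟨c, hc, fun _ => le_of_eq hc0, fun _ => le_of_eq hc0.symm⟩
    set w := δ / μ with hw
    have hwp : 0 < w := by positivity
    have hwμ : μ * w = δ := by rw [hw]; field_simp
    set Al := max A (c - w) with hAl
    set Br := min B (c + w) with hBr
    have hAAl : A ≤ Al := le_max_left _ _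
    have hBBr : Br ≤ B := min_le_left _ _
    have hAlc : Al ≤ c := max_le hc.1 (by linarith)
    have hcBr : c ≤ Br := le_min hc.2 (by linarith)
    have hlen : Br - Al ≤ 2 * w := by
      have := le_max_right A (c - w)
      have := min_le_right B (c + w)
      linarith
    have hexp : δ ^ (-(1:ℝ) / ((k:ℝ)+1)) = μ ^ (-(1:ℝ) / ((k:ℝ)+2)) := by
      rw [hδ, ← Real.rpow_mul hμ.le]
      congr 1
      field_simp
    have hwe : w = μ ^ (-(1:ℝ) / ((k:ℝ)+2)) := by
      rw [hw, hδ, div_eq_mul_inv, ← Real.rpow_neg_one μ, ← Real.rpow_add hμ]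
      congr 1
      field_simp
      ring
    have hIr : ‖∫ x in Br..B, Complex.exp (Complex.I * Complex.ofReal (p.eval x))‖ ≤
        K * δ ^ (-(1:ℝ) / ((k:ℝ)+1)) := by
      rcases le_or_gt B (c + w) with h | h
      · have : Br = B := min_eq_left h
        rw [this, intervalIntegral.integral_same, norm_zero]
        positivity
      · have hBe : Br = c + w := min_eq_right h.le
        apply ih p Br B δ hBBr hδp
        · intro x hx
          have hxm : x ∈ Set.Icc A B := ⟨by linarith [hx.1], hx.2⟩
          have g := hgrow c hc x hxm (by linarith [hx.1])
          have g2 := hc2 (by linarith)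
          have g3 : μ * w ≤ μ * (x - c) := mul_le_mul_of_nonneg_left (by linarith [hx.1]) hμ.le
          linarith
        · left
          intro x hx
          have := h1 x ⟨by linarith [hx.1], hx.2⟩
          rw [show k + 2 = k + 1 + 1 from rfl, hf']
          linarith
    have hIl : ‖∫ x in A..Al, Complex.exp (Complex.I * Complex.ofReal (p.eval x))‖ ≤
        K * δ ^ (-(1:ℝ) / ((k:ℝ)+1)) := by
      rcases le_or_gt (c - w) A with h | h
      · have : Al = A := max_eq_left h
        rw [this, intervalIntegral.integral_same, norm_zero]
        positivity
      · have hAe : Al = c - w := max_eq_right h.le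
        rw [← osc_neg]
        apply ih (-p) A Al δ hAAl hδp
        · intro x hx
          have hxm : x ∈ Set.Icc A B := ⟨hx.1, by linarith [hx.2]⟩
          have g := hgrow x hxm c hc (by linarith [hx.2])
          have g2 := hc1 (by linarith)
          have g3 : μ * w ≤ μ * (c - x) := mul_le_mul_of_nonneg_left (by linarith [hx.2]) hμ.le
          rw [Polynomial.iterate_derivative_neg, Polynomial.eval_neg, ← hf]
          linarith
        · right
          intro x hx
          have := h1 x ⟨hx.1, by linarith [hx.2]⟩
          rw [Polynomial.iterate_derivative_neg, Polynomial.eval_neg,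
            show k + 2 = k + 1 + 1 from rfl, hf']
          linarith
    have hIm := osc_triv p Al Br (by linarith)
    have hii : ∀ u v, IntervalIntegrable
        (fun x => Complex.exp (Complex.I * Complex.ofReal (p.eval x))) volume u v := by
      intro u v
      apply Continuous.intervalIntegrable
      have := p.continuous
      fun_prop
    rw [← intervalIntegral.integral_add_adjacent_intervals (hii A Br) (hii Br B),
      ← intervalIntegral.integral_add_adjacent_intervals (hii A Al) (hii Al Br)]
    rw [hexp] at hIl hIr
    have e1 : (((k+1:ℕ):ℝ)+1) = (k:ℝ)+2 := by push_cast; ring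
    rw [e1]
    refine (norm_add₃_le).trans ?_
    rw [hwe] at hlen
    linarith

/-- one-dimensional oscillatory estimate -/
lemma osc_one_dim (a : ℕ) (ha : 0 < a) : ∃ K : ℝ, 0 < K ∧ ∀ (p : Polynomial ℝ) (A B lam : ℝ), A ≤ B →
    lam ≠ 0 → p.natDegree ≤ a → p.coeff a ≠ 0 →
    ‖∫ x in A..B, Complex.exp (Complex.I * Complex.ofReal (lam * p.eval x))‖ ≤
      K * (|lam|⁻¹ / |p.coeff a|) ^ ((1:ℝ) / (a:ℝ)) := by
  obtain ⟨k, rfl⟩ : ∃ k, a = k + 1 := ⟨a - 1, by omega⟩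
  obtain ⟨K, hK, h⟩ := vdc k
  refine ⟨K, hK, ?_⟩
  intro p A B lam hAB hlam hdeg hc
  have key : ∀ q : Polynomial ℝ, q.natDegree ≤ k + 1 → 0 < q.coeff (k+1) →
      ‖∫ x in A..B, Complex.exp (Complex.I * Complex.ofReal (q.eval x))‖ ≤
      K * (q.coeff (k+1)) ^ (-(1:ℝ) / ((k:ℝ)+1)) := by
    intro q hq hq0
    have hd : Polynomial.derivative^[k+1] q = Polynomial.C (((k+1).factorial : ℝ) * q.coeff (k+1)) := by
      ext j
      rw [Polynomial.coeff_iterate_derivative, Polynomial.coeff_C]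
      split_ifs with hj
      · subst hj
        rw [zero_add, Nat.descFactorial_self, nsmul_eq_mul]
      · rw [Polynomial.coeff_eq_zero_of_natDegree_lt (by omega)]
        simp
    apply h q A B _ hAB hq0
    · intro x _
      rw [hd, Polynomial.eval_C]
      have : (1:ℝ) ≤ ((k+1).factorial : ℝ) := by exact_mod_cast Nat.succ_le_of_lt (Nat.factorial_pos _)
      nlinarith
    · left
      intro x _
      rw [show k + 2 = (k+1) + 1 from rfl, Function.iterate_succ_apply', hd]
      simp
  have hm : 0 < |lam * p.coeff (k+1)| := abs_pos.2 (mul_ne_zero hlam hc)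
  have hr : (|lam|⁻¹ / |p.coeff (k+1)|) ^ ((1:ℝ) / ((k+1:ℕ):ℝ)) =
      |lam * p.coeff (k+1)| ^ (-(1:ℝ) / ((k:ℝ)+1)) := by
    rw [neg_div, Real.rpow_neg hm.le, ← Real.inv_rpow hm.le, abs_mul, mul_inv, div_eq_mul_inv]
    push_cast
    rfl
  rw [hr]
  have hev : ∀ x, lam * p.eval x = (Polynomial.C lam * p).eval x := by intro x; simp
  simp_rw [hev]
  have hdq : (Polynomial.C lam * p).natDegree ≤ k + 1 := (Polynomial.natDegree_C_mul_le _ _).trans hdeg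
  rcases lt_or_gt_of_ne (mul_ne_zero hlam hc) with hs | hs
  · rw [← osc_neg]
    have := key (-(Polynomial.C lam * p)) (by rwa [Polynomial.natDegree_neg]) (by simp; linarith)
    rw [abs_of_neg hs]
    simpa using this
  · have := key (Polynomial.C lam * p) hdq (by simp; linarith)
    rw [abs_of_pos hs]
    simpa using this

/-- one-dimensional sublevel estimate -/
lemma sub_one_dim (a : ℕ) (ha : 0 < a) (p : Polynomial ℝ) (ε : ℝ) (hε : 0 < ε) (hdeg : p.natDegree ≤ a)
    (hc : p.coeff a ≠ 0) :
    volume {x : ℝ | |p.eval x| ≤ ε} ≤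
      ENNReal.ofReal (2 * a * (ε / |p.coeff a|) ^ ((1:ℝ) / (a:ℝ))) := by
  have hnd : p.natDegree = a := le_antisymm hdeg (Polynomial.le_natDegree_of_ne_zero hc)
  set q : Polynomial ℂ := p.map (algebraMap ℝ ℂ) with hq
  have hqd : q.natDegree = a := by rw [hq, Polynomial.natDegree_map, hnd]
  have hsp : q.Splits := IsAlgClosed.splits q
  have hcard : q.roots.card = a := by
    rw [← hqd]
    exact (Polynomial.Splits.natDegree_eq_card_roots hsp).symm
  set ρ := (ε / |p.coeff a|) ^ ((1:ℝ) / (a:ℝ)) with hρ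
  have hcp : 0 < |p.coeff a| := abs_pos.2 hc
  have hρp : 0 < ρ := Real.rpow_pos_of_pos (by positivity) _
  have hρa : ρ ^ a = ε / |p.coeff a| := by
    rw [hρ, ← Real.rpow_natCast, ← Real.rpow_mul (by positivity)]
    rw [one_div, inv_mul_cancel₀ (by positivity), Real.rpow_one]
  have hsub : {x : ℝ | |p.eval x| ≤ ε} ⊆ ⋃ z ∈ q.roots.toFinset, Set.Icc (z.re - ρ) (z.re + ρ) := by
    intro x hx
    by_contra hcon
    simp only [Set.mem_iUnion, not_exists] at hcon
    have hfar : ∀ z ∈ q.roots, ρ < ‖(x:ℂ) - z‖ := by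
      intro z hz
      have h1 := hcon z (Multiset.mem_toFinset.2 hz)
      have h2 : |((x:ℂ) - z).re| ≤ ‖(x:ℂ) - z‖ := Complex.abs_re_le_norm _
      refine lt_of_lt_of_le ?_ h2
      by_contra h3
      push Not at h3
      apply h1
      rw [abs_le] at h3
      simp at h3
      constructor <;> linarith [h3.1, h3.2]
    have hev : ((p.eval x : ℝ) : ℂ) = ((p.coeff a : ℝ) : ℂ) * (q.roots.map (fun z => (x:ℂ) - z)).prod := by
      have h1 : ((p.eval x : ℝ) : ℂ) = q.eval (x:ℂ) := by
        rw [hq, Polynomial.eval_map_algebraMap]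
        exact (Polynomial.aeval_algebraMap_apply_eq_algebraMap_eval (A := ℂ) x p).symm
      rw [h1, hsp.eval_eq_prod_roots]
      congr 1
      rw [Polynomial.leadingCoeff, hqd, hq, Polynomial.coeff_map]
      rfl
    have hn : ‖((p.eval x : ℝ) : ℂ)‖ = |p.eval x| := Complex.norm_real _
    have hlt : ∀ s : Multiset ℂ, s ≠ 0 → (∀ z ∈ s, ρ < ‖(x:ℂ) - z‖) →
        ρ ^ s.card < ‖(s.map (fun z => (x:ℂ) - z)).prod‖ := by
      intro s
      induction s using Multiset.induction_on with
      | empty => intro h; exact absurd rfl h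
      | cons z s ih =>
        intro _ hz
        rw [Multiset.map_cons, Multiset.prod_cons, norm_mul, Multiset.card_cons, pow_succ, mul_comm]
        have h1 := hz z (Multiset.mem_cons_self z s)
        by_cases hs : s = 0
        · subst hs
          simpa using h1
        · exact mul_lt_mul'' h1 (ih hs fun w hw => hz w (Multiset.mem_cons_of_mem hw)) hρp.le
            (by positivity)
    have hroots : q.roots ≠ 0 := by
      intro h0
      rw [h0] at hcard
      simp at hcard
      omega
    have h4 := hlt q.roots hroots hfar
    rw [hcard, hρa] at h4
    have h5 : |p.eval x| = |p.coeff a| * ‖(q.roots.map (fun z => (x:ℂ) - z)).prod‖ := by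
      rw [← hn, hev, norm_mul, Complex.norm_real]
      rfl
    have h6 : |p.eval x| ≤ ε := hx
    rw [div_lt_iff₀ hcp] at h4
    linarith
  refine (measure_mono hsub).trans ((measure_biUnion_finset_le _ _).trans ?_)
  have : ∀ z ∈ q.roots.toFinset, volume (Set.Icc (z.re - ρ) (z.re + ρ)) = ENNReal.ofReal (2 * ρ) := by
    intro z _
    rw [Real.volume_Icc]
    congr 1
    ring
  rw [Finset.sum_congr rfl this, Finset.sum_const, nsmul_eq_mul]
  have hle : (q.roots.toFinset.card : ENNReal) ≤ (a : ENNReal) := by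
    have := Multiset.toFinset_card_le q.roots
    rw [hcard] at this
    exact_mod_cast this
  refine (mul_le_mul_left hle _).trans (le_of_eq ?_)
  rw [show 2 * (a:ℝ) * ρ = a * (2 * ρ) by ring,
    ENNReal.ofReal_mul (p := (a:ℝ)) (by positivity), ENNReal.ofReal_natCast]

/-- the cube in `Fin n → ℝ` -/
def fcube (n : ℕ) (r : ℝ) : Set (Fin n → ℝ) := Set.univ.pi fun _ => Set.Ioo (-r) r

lemma fcube_meas (n : ℕ) (r : ℝ) : MeasurableSet (fcube n r) :=
  MeasurableSet.univ_pi fun _ => measurableSet_Ioo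

lemma fcube_vol (n : ℕ) (r : ℝ) (hr : 0 < r) :
    volume (fcube n r) = ENNReal.ofReal ((2 * r) ^ n) := by
  rw [fcube, Real.volume_pi_Ioo, Finset.prod_const, ← ENNReal.ofReal_pow (by linarith)]
  simp
  ring_nf

/-- `α` is the lexicographic leading exponent of `P` -/
def LexLead {n : ℕ} (P : MvPolynomial (Fin n) ℝ) (α : Fin n →₀ ℕ) : Prop :=
  MvPolynomial.coeff α P ≠ 0 ∧
    ∀ β : Fin n →₀ ℕ, β ≠ α → MvPolynomial.coeff β P ≠ 0 →
      ∃ j : Fin n, β j < α j ∧ ∀ k : Fin n, k < j → α k = β k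

/-- the leading coefficient with respect to the first variable -/
noncomputable def leadQ {n : ℕ} (P : MvPolynomial (Fin (n+1)) ℝ) (a : ℕ) : MvPolynomial (Fin n) ℝ :=
  (MvPolynomial.finSuccEquiv ℝ n P).coeff a

/-- the specialised one-variable polynomial -/
noncomputable def slice {n : ℕ} (P : MvPolynomial (Fin (n+1)) ℝ) (s : Fin n → ℝ) : Polynomial ℝ :=
  (MvPolynomial.finSuccEquiv ℝ n P).map (MvPolynomial.eval s)

lemma eval_slice {n : ℕ} (P : MvPolynomial (Fin (n+1)) ℝ) (s : Fin n → ℝ) (y : ℝ) :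
    MvPolynomial.eval (Fin.cons y s : Fin (n+1) → ℝ) P = (slice P s).eval y :=
  MvPolynomial.eval_eq_eval_mv_eval' s y P

lemma slice_coeff {n : ℕ} (P : MvPolynomial (Fin (n+1)) ℝ) (s : Fin n → ℝ) (a : ℕ) :
    (slice P s).coeff a = MvPolynomial.eval s (leadQ P a) := by
  rw [slice, Polynomial.coeff_map]
  rfl

lemma leadQ_lex {n : ℕ} (P : MvPolynomial (Fin (n+1)) ℝ) (α : Fin (n+1) →₀ ℕ) (h : LexLead P α) :
    LexLead (leadQ P (α 0)) α.tail := by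
  refine ⟨?_, ?_⟩
  · rw [leadQ, MvPolynomial.finSuccEquiv_coeff_coeff, Finsupp.cons_tail]
    exact h.1
  · intro β hβ hc
    rw [leadQ, MvPolynomial.finSuccEquiv_coeff_coeff] at hc
    obtain ⟨j, hj, hk⟩ := h.2 (Finsupp.cons (α 0) β) (by
      intro he
      apply hβ
      rw [← he, Finsupp.tail_cons]) hc
    induction j using Fin.cases with
    | zero => simp at hj
    | succ j =>
      refine ⟨j, ?_, ?_⟩
      · simpa [Finsupp.tail_apply] using hj
      · intro k hkj
        have := hk k.succ (Fin.succ_lt_succ_iff.2 hkj)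
        simpa [Finsupp.tail_apply] using this

lemma slice_deg {n : ℕ} (P : MvPolynomial (Fin (n+1)) ℝ) (α : Fin (n+1) →₀ ℕ) (h : LexLead P α)
    (s : Fin n → ℝ) : (slice P s).natDegree ≤ α 0 := by
  rw [Polynomial.natDegree_le_iff_coeff_eq_zero]
  intro i hi
  rw [slice_coeff]
  have : leadQ P i = 0 := by
    ext m
    rw [leadQ, MvPolynomial.finSuccEquiv_coeff_coeff, MvPolynomial.coeff_zero]
    by_contra hc
    obtain ⟨j, hj, hk⟩ := h.2 (Finsupp.cons i m) (by
      intro he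
      rw [← he] at hi
      simp at hi) hc
    induction j using Fin.cases with
    | zero => simp at hj; omega
    | succ j =>
      have := hk 0 (Fin.succ_pos j)
      simp at this
      omega
  rw [this, map_zero]

lemma lex_const {n : ℕ} (P : MvPolynomial (Fin n) ℝ) (α : Fin n →₀ ℕ) (h : LexLead P α)
    (h0 : ∑ i, α i = 0) : ∃ c : ℝ, c ≠ 0 ∧ ∀ s, MvPolynomial.eval s P = c := by
  have hα : ∀ i, α i = 0 := by
    intro i
    exact Finset.sum_eq_zero_iff.1 h0 i (Finset.mem_univ i)
  refine ⟨MvPolynomial.coeff α P, h.1, ?_⟩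
  have : P = MvPolynomial.C (MvPolynomial.coeff α P) := by
    ext m
    rw [MvPolynomial.coeff_C]
    have hα0 : α = 0 := by ext i; simp [hα i]
    split_ifs with hm
    · rw [← hm, hα0]
    · by_contra hc
      obtain ⟨j, hj, _⟩ := h.2 m (by rw [hα0]; exact Ne.symm hm) hc
      rw [hα j] at hj
      omega
  intro s
  conv_lhs => rw [this]
  simp

/-- the sublevel estimate for a polynomial with total leading exponent `m` -/
def SubEst {n : ℕ} (Q : MvPolynomial (Fin n) ℝ) (m : ℕ) : Prop :=
  ∃ C : ℝ, 0 < C ∧ ∀ ε r : ℝ, 0 < ε → 0 < r →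
    volume (fcube n r ∩ {x | |MvPolynomial.eval x Q| ≤ ε}) ≤
      ENNReal.ofReal (C * r ^ (n - 1) * ε ^ ((1:ℝ) / (m:ℝ)))

lemma core {n : ℕ} (Q : MvPolynomial (Fin n) ℝ) (α : Fin n →₀ ℕ) (hQ : LexLead Q α)
    (hsub : 0 < ∑ i, α i → SubEst Q (∑ i, α i)) (a : ℕ) (ha : 0 < a) (K : ℝ) (hK : 0 < K) :
    ∃ C : ℝ, 0 < C ∧ ∀ t r : ℝ, 0 < t → 0 < r → ∀ g : (Fin n → ℝ) → ENNReal,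
      (∀ x, g x ≤ ENNReal.ofReal (2 * r)) →
      (∀ x, MvPolynomial.eval x Q ≠ 0 →
        g x ≤ ENNReal.ofReal (K * (t / |MvPolynomial.eval x Q|) ^ ((1:ℝ) / (a:ℝ)))) →
      ∫⁻ x in fcube n r, g x ≤
        ENNReal.ofReal (C * r ^ n * t ^ ((1:ℝ) / ((a + ∑ i, α i : ℕ) : ℝ))) := by
  have haR : (0:ℝ) < a := by exact_mod_cast ha
  rcases Nat.eq_zero_or_pos (∑ i, α i) with h0 | hpos
  · obtain ⟨c, hc, hcQ⟩ := lex_const Q α hQ h0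
    have hcp : 0 < |c| := abs_pos.2 hc
    refine ⟨K * (1 / |c|) ^ ((1:ℝ) / (a:ℝ)) * 2 ^ n, by positivity, ?_⟩
    intro t r ht hr g _ h2
    have hb : ∀ x ∈ fcube n r, g x ≤ ENNReal.ofReal (K * (t / |c|) ^ ((1:ℝ) / (a:ℝ))) := by
      intro x _
      have := h2 x (by rw [hcQ]; exact hc)
      rwa [hcQ] at this
    refine (setLIntegral_mono' (fcube_meas n r) hb).trans ?_
    rw [setLIntegral_const, fcube_vol n r hr, ← ENNReal.ofReal_mul (by positivity)]
    apply le_of_eq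
    congr 1
    rw [h0, add_zero, show t / |c| = (1 / |c|) * t by ring,
      Real.mul_rpow (by positivity) ht.le, mul_pow]
    ring
  · obtain ⟨C, hC, hs⟩ := hsub hpos
    set m := ∑ i, α i with hm
    have hmR : (0:ℝ) < m := by exact_mod_cast hpos
    have hn : 0 < n := by
      rcases Nat.eq_zero_or_pos n with h | h
      · subst h
        simp at hm
        omega
      · exact h
    refine ⟨2 * C + K * 2 ^ n, by positivity, ?_⟩
    intro t r ht hr g h1 h2
    set δ : ℝ := t ^ ((m:ℝ) / ((a:ℝ) + m)) with hδ
    have hδp : 0 < δ := Real.rpow_pos_of_pos ht _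
    set τ : ℝ := t ^ ((1:ℝ) / ((a:ℝ) + m)) with hτ
    have hτp : 0 < τ := Real.rpow_pos_of_pos ht _
    have e1 : δ ^ ((1:ℝ) / (m:ℝ)) = τ := by
      rw [hδ, ← Real.rpow_mul ht.le]
      congr 1
      field_simp
    have e2 : (t / δ) ^ ((1:ℝ) / (a:ℝ)) = τ := by
      have : t / δ = t ^ ((a:ℝ) / ((a:ℝ) + m)) := by
        conv_lhs => rw [← Real.rpow_one t]
        rw [hδ, ← Real.rpow_sub ht]
        congr 1
        field_simp
        ring
      rw [this, ← Real.rpow_mul ht.le]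
      congr 1
      field_simp
    set S : Set (Fin n → ℝ) := {x | |MvPolynomial.eval x Q| ≤ δ} with hS
    have hSm : MeasurableSet S := by
      apply measurableSet_le
      · exact (MvPolynomial.continuous_eval Q).abs.measurable
      · exact measurable_const
    have hb : ∀ x ∈ fcube n r, g x ≤
        S.indicator (fun _ => ENNReal.ofReal (2 * r)) x + ENNReal.ofReal (K * τ) := by
      intro x _
      by_cases hx : x ∈ S
      · rw [Set.indicator_of_mem hx]
        exact (h1 x).trans le_self_add
      · have hx' : δ < |MvPolynomial.eval x Q| := by
          simpa [hS] using hx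
        refine le_trans ?_ le_add_self
        refine (h2 x (abs_pos.1 (hδp.trans hx'))).trans (ENNReal.ofReal_le_ofReal ?_)
        rw [← e2]
        apply mul_le_mul_of_nonneg_left _ hK.le
        apply Real.rpow_le_rpow (by positivity) _ (by positivity)
        exact div_le_div_of_nonneg_left ht.le hδp hx'.le
    refine (setLIntegral_mono' (fcube_meas n r) hb).trans ?_
    rw [lintegral_add_right _ measurable_const, setLIntegral_const, fcube_vol n r hr,
      lintegral_indicator_const hSm, Measure.restrict_apply hSm, Set.inter_comm]
    have hs' := hs δ r hδp hr
    rw [e1] at hs'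
    refine (add_le_add_left (mul_le_mul_right hs' _) _).trans ?_
    rw [← ENNReal.ofReal_mul (by positivity), ← ENNReal.ofReal_mul (by positivity),
      ← ENNReal.ofReal_add (by positivity) (by positivity)]
    apply le_of_eq
    congr 1
    obtain ⟨k, rfl⟩ : ∃ k, n = k + 1 := ⟨n - 1, by omega⟩
    push_cast
    rw [← hτ]
    ring

/-- the cons map -/
def consMap (n : ℕ) : ℝ × (Fin n → ℝ) → (Fin (n+1) → ℝ) := fun z => Fin.cons z.1 z.2

lemma consMap_eq (n : ℕ) : consMap n = (MeasurableEquiv.piFinSuccAbove (fun _ : Fin (n+1) => ℝ) 0).symm := by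
  ext z : 1
  rw [MeasurableEquiv.piFinSuccAbove_symm_apply]
  simp [consMap, Fin.insertNthEquiv]

lemma consMap_mp (n : ℕ) : MeasurePreserving (consMap n) volume volume := by
  rw [consMap_eq]
  exact (volume_preserving_piFinSuccAbove (fun _ : Fin (n+1) => ℝ) 0).symm _

lemma consMap_emb (n : ℕ) : MeasurableEmbedding (consMap n) := by
  rw [consMap_eq]
  exact MeasurableEquiv.measurableEmbedding _

lemma consMap_pre (n : ℕ) (r : ℝ) :
    consMap n ⁻¹' (fcube (n+1) r) = Set.Ioo (-r) r ×ˢ fcube n r := by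
  ext z
  simp only [Set.mem_preimage, fcube, Set.mem_univ_pi, consMap, Set.mem_prod]
  rw [Fin.forall_fin_succ]
  simp only [Fin.cons_zero, Fin.cons_succ]

lemma sublevel (n : ℕ) : ∀ (P : MvPolynomial (Fin n) ℝ) (α : Fin n →₀ ℕ), LexLead P α →
    0 < ∑ i, α i → SubEst P (∑ i, α i) := by
  induction n with
  | zero => intro P α _ h; simp at h
  | succ n ih =>
    intro P α hP hpos
    set Q := leadQ P (α 0) with hQ
    have hQl : LexLead Q α.tail := leadQ_lex P α hP
    have hsum : ∑ i, α i = α 0 + ∑ i, α.tail i := by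
      rw [Fin.sum_univ_succ]
      rfl
    have hvol : ∀ ε r : ℝ, volume (fcube (n+1) r ∩ {x | |MvPolynomial.eval x P| ≤ ε}) =
        ∫⁻ s in fcube n r, volume (Set.Ioo (-r) r ∩ {y | |(slice P s).eval y| ≤ ε}) := by
      intro ε r
      have hm : MeasurableSet (fcube (n+1) r ∩ {x | |MvPolynomial.eval x P| ≤ ε}) :=
        (fcube_meas _ _).inter (measurableSet_le
          (MvPolynomial.continuous_eval P).abs.measurable measurable_const)
      rw [← (consMap_mp n).measure_preimage hm.nullMeasurableSet]
      rw [Measure.volume_eq_prod, Measure.prod_apply_symm ((consMap_emb n).measurable hm),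
        ← lintegral_indicator (fcube_meas n r)]
      congr 1
      ext s
      rw [Set.preimage_inter, consMap_pre]
      by_cases hs : s ∈ fcube n r
      · rw [Set.indicator_of_mem hs]
        congr 1
        ext y
        simp [hs, consMap, eval_slice]
      · rw [Set.indicator_of_notMem hs]
        convert measure_empty
        · ext y
          simp [hs]
        · infer_instance
    have hIoo : ∀ r : ℝ, ∀ U : Set ℝ, volume (Set.Ioo (-r) r ∩ U) ≤ ENNReal.ofReal (2 * r) := by
      intro r U
      refine (measure_mono Set.inter_subset_left).trans (le_of_eq ?_)
      rw [Real.volume_Ioo]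
      congr 1
      ring
    rcases Nat.eq_zero_or_pos (α 0) with h0 | ha
    · have hpos' : 0 < ∑ i, α.tail i := by omega
      obtain ⟨C, hC, hs⟩ := ih Q α.tail hQl hpos'
      have hn : 0 < n := by
        rcases Nat.eq_zero_or_pos n with h | h
        · subst h
          simp at hpos'
        · exact h
      refine ⟨2 * C, by positivity, ?_⟩
      intro ε r hε hr
      rw [hvol]
      have hev : ∀ s y, (slice P s).eval y = MvPolynomial.eval s Q := by
        intro s y
        have hd := slice_deg P α hP s
        rw [h0] at hd
        rw [Polynomial.eq_C_of_natDegree_le_zero hd, Polynomial.eval_C, slice_coeff, hQ, h0]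
      set S : Set (Fin n → ℝ) := {x | |MvPolynomial.eval x Q| ≤ ε} with hS
      have hSm : MeasurableSet S := by
        apply measurableSet_le
        · exact (MvPolynomial.continuous_eval Q).abs.measurable
        · exact measurable_const
      have hb : ∀ s ∈ fcube n r, volume (Set.Ioo (-r) r ∩ {y | |(slice P s).eval y| ≤ ε}) ≤
          S.indicator (fun _ => ENNReal.ofReal (2 * r)) s := by
        intro s _
        by_cases hs : s ∈ S
        · rw [Set.indicator_of_mem hs]
          exact hIoo _ _
        · rw [Set.indicator_of_notMem hs]
          have : {y | |(slice P s).eval y| ≤ ε} = ∅ := by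
            ext y
            simp only [Set.mem_ofPred_eq, hev, Set.mem_empty_iff_false, iff_false]
            exact hs
          rw [this, Set.inter_empty, measure_empty]
      refine (setLIntegral_mono' (fcube_meas n r) hb).trans ?_
      rw [lintegral_indicator_const hSm, Measure.restrict_apply hSm, Set.inter_comm]
      refine (mul_le_mul_right (hs ε r hε hr) _).trans ?_
      rw [← ENNReal.ofReal_mul (by positivity), hsum, h0, zero_add]
      apply le_of_eq
      congr 1
      obtain ⟨k, rfl⟩ : ∃ k, n = k + 1 := ⟨n - 1, by omega⟩
      simp only [Nat.add_sub_cancel]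
      ring
    · obtain ⟨C, hC, hcore⟩ := core Q α.tail hQl (ih Q α.tail hQl) (α 0) ha (2 * (α 0 : ℕ))
        (by positivity)
      refine ⟨C, hC, ?_⟩
      intro ε r hε hr
      rw [hvol, hsum]
      apply hcore ε r hε hr
      · intro s
        exact hIoo _ _
      · intro s hs
        refine (measure_mono Set.inter_subset_right).trans ?_
        have := sub_one_dim (α 0) ha (slice P s) ε hε (slice_deg P α hP s)
          (by rw [slice_coeff]; exact hs)
        rwa [slice_coeff] at this

lemma osc_lex (n : ℕ) (P : MvPolynomial (Fin (n+1)) ℝ) (α : Fin (n+1) →₀ ℕ) (hP : LexLead P α)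
    (ha : 0 < α 0) : ∃ C : ℝ, 0 < C ∧ ∀ lam r : ℝ, lam ≠ 0 → 0 < r →
      ‖∫ x in fcube (n+1) r,
        Complex.exp (Complex.I * Complex.ofReal (lam * MvPolynomial.eval x P))‖ ≤
      C * r ^ n * (|lam|⁻¹) ^ ((1:ℝ) / ((∑ i, α i : ℕ) : ℝ)) := by
  have hsum : ∑ i, α i = α 0 + ∑ i, α.tail i := by
    rw [Fin.sum_univ_succ]
    rfl
  set Q := leadQ P (α 0) with hQ
  have hQl : LexLead Q α.tail := leadQ_lex P α hP
  obtain ⟨K, hK, hosc⟩ := osc_one_dim (α 0) ha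
  obtain ⟨C, hC, hcore⟩ := core Q α.tail hQl (sublevel n Q α.tail hQl) (α 0) ha K hK
  refine ⟨C, hC, ?_⟩
  intro lam r hlam hr
  set F : (Fin (n+1) → ℝ) → ℂ := fun x =>
    Complex.exp (Complex.I * Complex.ofReal (lam * MvPolynomial.eval x P)) with hF
  have hFn : ∀ x, ‖F x‖ = 1 := by
    intro x
    simp only [hF]
    rw [mul_comm, Complex.norm_exp_ofReal_mul_I]
  have hFc : Continuous F := by
    have := MvPolynomial.continuous_eval P
    simp only [hF]
    fun_prop
  have hfin : volume (fcube n r) < ⊤ := by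
    rw [fcube_vol n r hr]
    exact ENNReal.ofReal_lt_top
  have h1 : ∫ x in fcube (n+1) r, F x =
      ∫ s in fcube n r, ∫ y in Set.Ioo (-r) r, F (Fin.cons y s) := by
    rw [← (consMap_mp n).setIntegral_preimage_emb (consMap_emb n), consMap_pre,
      Measure.volume_eq_prod, ← Measure.prod_restrict, integral_prod_symm]
    · rfl
    · rw [Measure.prod_restrict]
      apply Measure.integrableOn_of_bounded (M := 1)
      · rw [Measure.prod_prod]
        exact (ENNReal.mul_lt_top (by simp) hfin).ne
      · exact (hFc.measurable.comp (consMap_emb n).measurable).aestronglyMeasurable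
      · exact Filter.Eventually.of_forall fun z => (hFn _).le
  have hinner : ∀ s, ∫ y in Set.Ioo (-r) r, F (Fin.cons y s) =
      ∫ y in (-r)..r, Complex.exp (Complex.I * Complex.ofReal (lam * (slice P s).eval y)) := by
    intro s
    rw [intervalIntegral.integral_of_le (by linarith), ← integral_Ioc_eq_integral_Ioo]
    simp only [hF, eval_slice]
  have h2 : ‖∫ x in fcube (n+1) r, F x‖ₑ ≤
      ENNReal.ofReal (C * r ^ n * (|lam|⁻¹) ^ ((1:ℝ) / ((∑ i, α i : ℕ) : ℝ))) := by
    rw [h1]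
    refine (enorm_integral_le_lintegral_enorm _).trans ?_
    rw [hsum]
    apply hcore (|lam|⁻¹) r (by positivity) hr
    · intro s
      rw [← ofReal_norm, hinner]
      apply ENNReal.ofReal_le_ofReal
      have := osc_triv (Polynomial.C lam * slice P s) (-r) r (by linarith)
      simp only [Polynomial.eval_mul, Polynomial.eval_C] at this
      linarith
    · intro s hs
      rw [← ofReal_norm, hinner]
      apply ENNReal.ofReal_le_ofReal
      have := hosc (slice P s) (-r) r lam (by linarith) hlam (slice_deg P α hP s)
        (by rw [slice_coeff]; exact hs)
      rwa [slice_coeff] at this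
  rw [← ofReal_norm] at h2
  exact (ENNReal.ofReal_le_ofReal_iff (by positivity)).1 h2

/-- **Proposition 4.3.** For a polynomial `P` on `ℝ^n` (admitting an admissible
monomial) and `I_r(λ) = ∫_{Δ_r^n} e^{iλP}`, there is a constant `C > 0` independent of
`λ` and `r` with `|I_r(λ)| ≤ C r^{n-1} |λ|^{-1/ad(P)}` for `|λ| > 1`, `r > 1`. -/
theorem statement14 (n : ℕ) (P : MvPolynomial (Fin n) ℝ)
    (hadm : ∃ α : Fin n →₀ ℕ, IsAdmissibleIndex P α) :
    ∃ C : ℝ, 0 < C ∧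
      ∀ lam r : ℝ, 1 < |lam| → 1 < r →
        ‖∫ x in cube n r,
            Complex.exp (Complex.I * Complex.ofReal (lam * eval (fun i => x i) P))‖ ≤
          C * r ^ (n - 1) * |lam| ^ (-(1 : ℝ) / (admissibleDegree P : ℝ)) := by
  classical
  have hne : {k : ℕ | ∃ α : Fin n →₀ ℕ, IsAdmissibleIndex P α ∧ (∑ i, α i) = k}.Nonempty := by
    obtain ⟨α, h⟩ := hadm
    exact ⟨_, α, h, rfl⟩
  obtain ⟨α, ⟨hα, σ, ⟨hn, hσ⟩, hlex⟩, hdeg⟩ := Nat.sInf_mem hne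
  change _ = admissibleDegree P at hdeg
  obtain ⟨k, rfl⟩ : ∃ k, n = k + 1 := ⟨n - 1, by omega⟩
  have hmd : ∀ β : Fin (k+1) →₀ ℕ, ∀ i, (Finsupp.mapDomain σ.symm β) i = β (σ i) := by
    intro β i
    rw [Finsupp.mapDomain_equiv_apply]
    rfl
  have hL : LexLead (rename σ.symm P) (Finsupp.mapDomain σ.symm α) := by
    refine ⟨?_, ?_⟩
    · rw [coeff_rename_mapDomain _ σ.symm.injective]
      exact hα
    · intro β hβ hc
      have hβ' : β = Finsupp.mapDomain σ.symm (Finsupp.mapDomain σ β) := by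
        ext i
        rw [hmd, Finsupp.mapDomain_equiv_apply, Equiv.symm_apply_apply]
      rw [hβ'] at hβ hc ⊢
      rw [coeff_rename_mapDomain _ σ.symm.injective] at hc
      obtain ⟨j, hj, hk⟩ := hlex (Finsupp.mapDomain σ β) (fun h => hβ (by rw [h])) hc
      refine ⟨j, ?_, ?_⟩
      · rw [hmd, hmd]
        exact hj
      · intro i hi
        rw [hmd, hmd]
        exact hk i hi
  obtain ⟨C, hC, hmain⟩ := osc_lex k (rename σ.symm P) (Finsupp.mapDomain σ.symm α) hL (by
    rw [hmd]
    exact hσ)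
  have hsum : ∑ i, (Finsupp.mapDomain σ.symm α) i = admissibleDegree P := by
    rw [← hdeg]
    simp_rw [hmd]
    exact Equiv.sum_comp σ (fun i => α i)
  refine ⟨C, hC, ?_⟩
  intro lam r hlam hr
  have hm := hmain lam r (by rintro rfl; norm_num at hlam) (by linarith)
  rw [hsum] at hm
  have h1 : ∫ x in cube (k+1) r,
      Complex.exp (Complex.I * Complex.ofReal (lam * eval (fun i => x i) P)) =
      ∫ x in fcube (k+1) r, Complex.exp (Complex.I * Complex.ofReal (lam * eval x P)) := by
    rw [← (PiLp.volume_preserving_ofLp (Fin (k+1))).setIntegral_preimage_emb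
      (MeasurableEquiv.toLp 2 (Fin (k+1) → ℝ)).symm.measurableEmbedding]
    have : cube (k+1) r = WithLp.ofLp ⁻¹' fcube (k+1) r := by
      ext x
      simp [cube, fcube]
    rw [this]
  have h2 : ∫ x in fcube (k+1) r, Complex.exp (Complex.I * Complex.ofReal (lam * eval x P)) =
      ∫ x in fcube (k+1) r,
        Complex.exp (Complex.I * Complex.ofReal (lam * eval x (rename σ.symm P))) := by
    have hap : ∀ x : Fin (k+1) → ℝ,
        MeasurableEquiv.piCongrLeft (fun _ : Fin (k+1) => ℝ) σ x = x ∘ σ.symm := by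
      intro x
      ext i
      obtain ⟨j, rfl⟩ := σ.surjective i
      rw [MeasurableEquiv.coe_piCongrLeft]
      simp [Equiv.piCongrLeft_apply_apply]
    rw [← (volume_measurePreserving_piCongrLeft (fun _ : Fin (k+1) => ℝ) σ).setIntegral_preimage_emb
      (MeasurableEquiv.measurableEmbedding _)]
    have : (MeasurableEquiv.piCongrLeft (fun _ : Fin (k+1) => ℝ) σ) ⁻¹' fcube (k+1) r
        = fcube (k+1) r := by
      ext x
      simp only [Set.mem_preimage, hap, fcube, Set.mem_univ_pi, Function.comp]
      exact ⟨fun h i => by simpa using h (σ i), fun h i => h _⟩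
    rw [this]
    simp only [hap, eval_rename]
  rw [h1, h2, neg_div, Real.rpow_neg (abs_nonneg _), ← Real.inv_rpow (abs_nonneg _)]
  exact hm
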